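/- Let d ≥ 3 and fix t ∈ (−1,1). Suppose there exists a unitary W ∈ U(d−1) such that, taking V_m = W for all m and A_m = S^{−(m−1)}(t ⊕ V_m)S^{m−1}, the family {A_m* A_n}_{m,n=1}^d is linearly independent. Then the set of d-tuples (V₁,…,V_d) ∈ U(d−1)^d for which the associated matrices A_m = S^{−(m−1)}(t ⊕ V_m)S^{m−1} yield a linearly independent family {A_m* A_n}_{m,n=1}^d is a co-null set in U(d−1)^d with respect to the normalized Haar measure on U(d−1)^d; equivalently, the set of tuples yielding a linearly dependent family is Haar-null. -/

import Mathlib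

open MeasureTheory Matrix

noncomputable section

/-- The cyclic shift matrix `S = ∑_k |e_k⟩⟨e_{k+1}|` (indices mod `d`). -/
def cyclicShift (d : ℕ) : Matrix (Fin d) (Fin d) ℂ :=
  Matrix.of fun j k => if (k : ℕ) = ((j : ℕ) + 1) % d then 1 else 0

/-- The block-diagonal matrix `t ⊕ V ∈ M_d(ℂ)` with `(1,1)` entry `t` and lower-right
`(d−1)×(d−1)` block `V`. -/
def blockTV (d : ℕ) (t : ℂ) (V : Matrix (Fin (d - 1)) (Fin (d - 1)) ℂ) :
    Matrix (Fin d) (Fin d) ℂ :=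
  Matrix.of fun j k =>
    if h : (j : ℕ) = 0 ∨ (k : ℕ) = 0 then
      (if (j : ℕ) = 0 ∧ (k : ℕ) = 0 then t else 0)
    else V ⟨(j : ℕ) - 1, by have := j.isLt; omega⟩ ⟨(k : ℕ) - 1, by have := k.isLt; omega⟩

/-- `A_m = S^{−(m−1)} (t ⊕ V_m) S^{m−1}` (with `m : Fin d` corresponding to
`m+1 ∈ {1,…,d}`). -/
def keyA (d : ℕ) (t : ℂ) (V : Fin d → Matrix (Fin (d - 1)) (Fin (d - 1)) ℂ) (m : Fin d) :
    Matrix (Fin d) (Fin d) ℂ :=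
  ((cyclicShift d) ^ (m : ℕ))ᴴ * blockTV d t (V m) * (cyclicShift d) ^ (m : ℕ)

/-- The Borel σ-algebra on the unitary group `U(d−1)`. -/
instance unitaryGroupMeasurableSpace (n : ℕ) :
    MeasurableSpace (Matrix.unitaryGroup (Fin n) ℂ) := borel _

instance unitaryGroupBorelSpace (n : ℕ) :
    BorelSpace (Matrix.unitaryGroup (Fin n) ℂ) := ⟨rfl⟩

open scoped Matrix.Norms.L2Operator in
/-- Every unitary matrix is the exponential of `i` times a Hermitian matrix. -/
theorem exists_expUnitary_eq {n : Type*} [Fintype n] [DecidableEq n]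
    (u : Matrix.unitaryGroup n ℂ) :
    ∃ a : selfAdjoint (Matrix n n ℂ), selfAdjoint.expUnitary a = u := by
  refine ⟨Unitary.argSelfAdjoint u, Subtype.ext ?_⟩
  have hcont : ContinuousOn Complex.arg (spectrum ℂ (u : Matrix n n ℂ)) :=
    (Matrix.finite_spectrum (u : Matrix n n ℂ)).continuousOn _
  rw [selfAdjoint.expUnitary_coe, Unitary.argSelfAdjoint_coe,
    ← CFC.exp_eq_normedSpace_exp (𝕜 := ℂ), ← cfc_comp_smul .., ← cfc_comp' ..]
  conv_rhs => rw [← cfc_id' ℂ (u : Matrix n n ℂ)]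
  refine cfc_congr fun y hy ↦ ?_
  have hy₁ : ‖y‖ = 1 := spectrum.norm_eq_one_of_unitary u.2 hy
  have hlog : Complex.I * y.arg = Complex.log y :=
    Complex.ext (by simp [Complex.log_re, hy₁]) (by simp [Complex.log_im])
  have hy₀ : y ≠ 0 := by
    rintro rfl
    simp at hy₁
  simpa [← Complex.exp_eq_exp_ℂ, hlog] using Complex.exp_log hy₀

open scoped Matrix.Norms.L2Operator in
/-- Every unitary matrix `u` lies on a one-parameter group with analytic entries; `γ` is the
parametrization of that group with `γ 1 = u`. -/
theorem exists_analytic_curve_unitaryGroup {n : Type*} [Fintype n] [DecidableEq n]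
    (u : Matrix.unitaryGroup n ℂ) :
    ∃ γ : ℝ → Matrix.unitaryGroup n ℂ, Continuous γ ∧ (∀ s, γ (s + 1) = u * γ s) ∧
      ∀ i j s, AnalyticAt ℝ (fun s => (γ s : Matrix n n ℂ) i j) s := by
  obtain ⟨a, rfl⟩ := exists_expUnitary_eq u
  refine ⟨fun s => selfAdjoint.expUnitary (s • a), ?_, fun s => ?_, fun i j s => ?_⟩
  · exact selfAdjoint.continuous_expUnitary.comp (by fun_prop)
  · have hcomm : Commute ((a : Matrix n n ℂ)) ((s • a : selfAdjoint (Matrix n n ℂ)) :) := by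
      simp [Commute, SemiconjBy]
    simp only [← hcomm.expUnitary_add, add_smul, one_smul, add_comm]
  · let entry : Matrix n n ℂ →L[ℝ] ℂ :=
      LinearMap.toContinuousLinearMap
        { toFun := fun M => M i j, map_add' := fun _ _ => rfl, map_smul' := fun _ _ => rfl }
    have hlin : AnalyticAt ℝ (fun s : ℝ => Complex.I • s • (a : Matrix n n ℂ)) s := by fun_prop
    have hexp : AnalyticAt ℝ (NormedSpace.exp : Matrix n n ℂ → Matrix n n ℂ)
        (Complex.I • s • (a : Matrix n n ℂ)) := NormedSpace.exp_analytic _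
    exact (entry.analyticAt _).comp (hexp.comp_of_eq hlin rfl)

/-- The zero set of a real-analytic function on `ℝ` that is not identically zero is null. -/
theorem ae_ne_zero_of_analyticOnNhd {f : ℝ → ℂ} (hf : ∀ s, AnalyticAt ℝ f s) {x : ℝ}
    (hx : f x ≠ 0) : ∀ᵐ s : ℝ, f s ≠ 0 := by
  have hcod : f ⁻¹' {0}ᶜ ∈ Filter.codiscrete ℝ :=
    AnalyticOnNhd.preimage_zero_mem_codiscrete (fun s _ => hf s) hx
  have hcount : (f ⁻¹' {0}ᶜ)ᶜ.Countable :=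
    (HereditarilyLindelofSpace.isLindelof _).countable_of_isDiscrete
      (by simpa using isDiscrete_of_codiscreteWithin (s := f ⁻¹' {0}) (U := Set.univ) hcod)
  exact hcount.measure_zero volume

/-- If every element `g` of a group lies on a curve `γ` with `γ (s + 1) = g * γ s` along whose
right translates `f` is analytic, then the zero set of `f` is null for every left-invariant
measure unless `f` vanishes identically. -/
theorem measure_zeros_eq_zero_of_analytic_curves {G : Type*} [Group G] [TopologicalSpace G]
    [IsTopologicalGroup G] [SecondCountableTopology G] [MeasurableSpace G] [BorelSpace G]
    (μ : Measure G) [SFinite μ] [μ.IsMulLeftInvariant] {f : G → ℂ} (hf : Continuous f)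
    (hne : ∃ g, f g ≠ 0)
    (hγ : ∀ g, ∃ γ : ℝ → G, Continuous γ ∧ (∀ s, γ (s + 1) = g * γ s) ∧
      ∀ V s, AnalyticAt ℝ (fun s => f (γ s * V)) s) :
    μ {g | f g = 0} = 0 := by
  have key : ∀ g, ∀ᵐ V ∂μ, f V = 0 → f (g * V) = 0 := by
    intro g
    obtain ⟨γ, hγc, hγ1, hγa⟩ := hγ g
    have hmeas : MeasurableSet {q : G × ℝ | f (γ q.2 * q.1) = 0 → f (g * (γ q.2 * q.1)) = 0} :=
      MeasurableSet.imp
        (isClosed_singleton.preimage (by fun_prop : Continuous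
          fun q : G × ℝ => f (γ q.2 * q.1))).measurableSet
        (isClosed_singleton.preimage (by fun_prop : Continuous
          fun q : G × ℝ => f (g * (γ q.2 * q.1)))).measurableSet
    have hV : ∀ᵐ V ∂μ, ∀ᵐ s : ℝ, f (γ s * V) = 0 → f (g * (γ s * V)) = 0 := by
      refine .of_forall fun V => ?_
      by_cases hz : ∀ s, f (γ s * V) = 0
      · refine .of_forall fun s _ => ?_
        rw [← mul_assoc, ← hγ1]
        exact hz _
      · push Not at hz
        obtain ⟨x, hx⟩ := hz
        filter_upwards [ae_ne_zero_of_analyticOnNhd (hγa V) hx] with s hs h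
        exact absurd h hs
    obtain ⟨s, hs⟩ := ((Measure.ae_ae_comm hmeas).1 hV).exists
    have := (measurePreserving_mul_left μ (γ s)⁻¹).quasiMeasurePreserving.ae hs
    simpa using this
  have hall : ∀ᵐ V ∂μ, ∀ k, f V = 0 → f (TopologicalSpace.denseSeq G k * V) = 0 :=
    ae_all_iff.2 fun k => key _
  refine measure_mono_null ?_ hall
  intro V hV hVall
  obtain ⟨g, hg⟩ := hne
  have hzero : (fun h => f (h * V)) = fun _ => 0 :=
    Continuous.ext_on (TopologicalSpace.denseRange_denseSeq G) (by fun_prop) continuous_const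
      (by rintro _ ⟨k, rfl⟩; exact hVall k hV)
  exact hg (by simpa using congrFun hzero (g * V⁻¹))

/-- The square matrix whose rows are the flattenings of the products `A_mᴴ * A_n`. -/
def gramRows (d : ℕ) (t : ℂ) (V : Fin d → Matrix (Fin (d - 1)) (Fin (d - 1)) ℂ) :
    Matrix (Fin d × Fin d) (Fin d × Fin d) ℂ :=
  Matrix.of fun p q => ((keyA d t V p.1)ᴴ * keyA d t V p.2) q.1 q.2

theorem linearIndependent_iff_det_gramRows_ne_zero (d : ℕ) (t : ℂ)
    (V : Fin d → Matrix (Fin (d - 1)) (Fin (d - 1)) ℂ) :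
    LinearIndependent ℂ (fun p : Fin d × Fin d => (keyA d t V p.1)ᴴ * keyA d t V p.2) ↔
      (gramRows d t V).det ≠ 0 := by
  let e : Matrix (Fin d) (Fin d) ℂ ≃ₗ[ℂ] (Fin d × Fin d → ℂ) :=
    (LinearEquiv.curry ℂ ℂ (Fin d) (Fin d)).symm
  rw [← isUnit_iff_ne_zero, ← Matrix.isUnit_iff_isUnit_det,
    ← Matrix.linearIndependent_rows_iff_isUnit,
    ← LinearMap.linearIndependent_iff e.toLinearMap e.ker]
  have hrow : e.toLinearMap ∘ (fun p : Fin d × Fin d => (keyA d t V p.1)ᴴ * keyA d t V p.2) =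
      (gramRows d t V).row := rfl
  rw [hrow]

theorem analyticAt_mul_apply {l m n : Type*} [Fintype m] {M : ℝ → Matrix l m ℂ}
    {N : ℝ → Matrix m n ℂ} {s : ℝ} (hM : ∀ i j, AnalyticAt ℝ (fun s => M s i j) s)
    (hN : ∀ i j, AnalyticAt ℝ (fun s => N s i j) s) (i : l) (j : n) :
    AnalyticAt ℝ (fun s => (M s * N s) i j) s := by
  simp only [Matrix.mul_apply]
  exact Finset.analyticAt_fun_sum _ fun k _ => (hM i k).mul (hN k j)

theorem analyticAt_conjTranspose_apply {m n : Type*} {M : ℝ → Matrix m n ℂ} {s : ℝ}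
    (hM : ∀ i j, AnalyticAt ℝ (fun s => M s i j) s) (i : n) (j : m) :
    AnalyticAt ℝ (fun s => (M s)ᴴ i j) s :=
  ((Complex.conjCLE : ℂ →L[ℝ] ℂ).analyticAt _).comp (hM j i)

theorem analyticAt_keyA_apply {d : ℕ} {t : ℂ}
    {V : ℝ → Fin d → Matrix (Fin (d - 1)) (Fin (d - 1)) ℂ} {s : ℝ}
    (hV : ∀ m i j, AnalyticAt ℝ (fun s => V s m i j) s) (m i j : Fin d) :
    AnalyticAt ℝ (fun s => keyA d t (V s) m i j) s := by
  have hblock : ∀ i j, AnalyticAt ℝ (fun s => blockTV d t (V s m) i j) s := fun i j => by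
    simp only [blockTV, Matrix.of_apply]
    split_ifs
    · exact analyticAt_const
    · exact analyticAt_const
    · exact hV _ _ _
  unfold keyA
  have hleft : ∀ i j, AnalyticAt ℝ
      (fun s => (((cyclicShift d) ^ (m : ℕ))ᴴ * blockTV d t (V s m)) i j) s :=
    analyticAt_mul_apply (M := fun _ => ((cyclicShift d) ^ (m : ℕ))ᴴ)
      (fun _ _ => analyticAt_const) hblock
  exact analyticAt_mul_apply hleft (N := fun _ => (cyclicShift d) ^ (m : ℕ))
    (fun _ _ => analyticAt_const) i j

theorem analyticAt_det_gramRows {d : ℕ} {t : ℂ}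
    {V : ℝ → Fin d → Matrix (Fin (d - 1)) (Fin (d - 1)) ℂ} {s : ℝ}
    (hV : ∀ m i j, AnalyticAt ℝ (fun s => V s m i j) s) :
    AnalyticAt ℝ (fun s => (gramRows d t (V s)).det) s := by
  simp only [Matrix.det_apply']
  exact Finset.analyticAt_fun_sum _ fun σ _ => analyticAt_const.mul <|
    Finset.analyticAt_fun_prod _ fun p _ =>
      analyticAt_mul_apply (analyticAt_conjTranspose_apply (analyticAt_keyA_apply hV _))
        (analyticAt_keyA_apply hV _) _ _

theorem continuous_det_gramRows (d : ℕ) (t : ℂ) :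
    Continuous fun V : Fin d → Matrix (Fin (d - 1)) (Fin (d - 1)) ℂ =>
      (gramRows d t V).det := by
  have hblock : Continuous (blockTV d t) := by
    refine continuous_matrix fun i j => ?_
    simp only [blockTV, Matrix.of_apply]
    split_ifs <;> fun_prop
  have hkey : ∀ m, Continuous fun V => keyA d t V m := fun m => by
    unfold keyA
    fun_prop
  refine Continuous.matrix_det (continuous_matrix fun p q => ?_)
  exact ((hkey p.1).matrix_conjTranspose.matrix_mul (hkey p.2)).matrix_elem _ _

/-- Suppose for some single unitary `W ∈ U(d−1)` (used for all `V_m`) the family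
`{A_m* A_n}` is linearly independent. Then the set of `d`-tuples
`(V₁,…,V_d) ∈ U(d−1)^d` for which the family `{A_m* A_n}` is linearly dependent is a
null set for the normalized Haar measure on `U(d−1)^d`. -/
theorem linearIndependent_coNull_tuples (d : ℕ) (hd : 3 ≤ d) (t : ℝ)
    (ht : t ∈ Set.Ioo (-1 : ℝ) 1)
    (hW : ∃ W : Matrix (Fin (d - 1)) (Fin (d - 1)) ℂ,
      W ∈ Matrix.unitaryGroup (Fin (d - 1)) ℂ ∧
      LinearIndependent ℂ (fun p : Fin d × Fin d =>
        (keyA d (t : ℂ) (fun _ => W) p.1)ᴴ * keyA d (t : ℂ) (fun _ => W) p.2))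
    (μ : Measure (Fin d → Matrix.unitaryGroup (Fin (d - 1)) ℂ))
    (hHaar : μ.IsHaarMeasure) (hProb : IsProbabilityMeasure μ) :
    μ {V : Fin d → Matrix.unitaryGroup (Fin (d - 1)) ℂ |
        ¬ LinearIndependent ℂ (fun p : Fin d × Fin d =>
          (keyA d (t : ℂ) (fun m => (V m : Matrix (Fin (d - 1)) (Fin (d - 1)) ℂ)) p.1)ᴴ *
            keyA d (t : ℂ) (fun m => (V m : Matrix (Fin (d - 1)) (Fin (d - 1)) ℂ)) p.2)} = 0 := by
  obtain ⟨W, hWU, hWli⟩ := hW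
  simp only [linearIndependent_iff_det_gramRows_ne_zero, not_not] at hWli ⊢
  have : SecondCountableTopology (Matrix (Fin (d - 1)) (Fin (d - 1)) ℂ) :=
    inferInstanceAs (SecondCountableTopology (Fin (d - 1) → Fin (d - 1) → ℂ))
  have : SecondCountableTopology (Matrix.unitaryGroup (Fin (d - 1)) ℂ) :=
    TopologicalSpace.Subtype.secondCountableTopology _
  refine measure_zeros_eq_zero_of_analytic_curves μ
    (f := fun V : Fin d → Matrix.unitaryGroup (Fin (d - 1)) ℂ =>
      (gramRows d t fun m => (V m : Matrix (Fin (d - 1)) (Fin (d - 1)) ℂ)).det)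
    ((continuous_det_gramRows d t).comp (by fun_prop)) ⟨fun _ => ⟨W, hWU⟩, hWli⟩ fun g => ?_
  choose γ hγc hγ1 hγa using fun m => exists_analytic_curve_unitaryGroup (g m)
  refine ⟨fun s m => γ m s, continuous_pi hγc, fun s => funext fun m => hγ1 m s, fun V s => ?_⟩
  exact analyticAt_det_gramRows fun m =>
    analyticAt_mul_apply (fun i j => hγa m i j s) fun _ _ => analyticAt_const

end
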